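/- Fix an integer N ≥ 3 and parameters λ_1, λ_2, … in [0,1]. Let ρ_1 = |C_N⟩⟨C_N| be the N-qubit linear cluster state and ρ_k = (id ⊗ Φ_{λ_{k−1}})(ρ_{k−1}) for k ≥ 2 (the map acting on the N-th qubit). Then for every k ≥ 1, Tr(W_C^{λ_k} ρ_k) = 1 − ∏_{j=1}^{k−1} (1+√(1−λ_j²))/2 − λ_k/2^{k−1}. Consequently the k-th sequential observer detects genuine multipartite entanglement, i.e., Tr(W_C^{λ_k} ρ_k) < 0, if and only if λ_k > 2^{k−1}·[1 − ∏_{j=1}^{k−1} (1+√(1−λ_j²))/2] — the same N-independent condition as for the GHZ state. -/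

import Mathlib

open Matrix
open scoped ComplexOrder

noncomputable section

/-- The space of operators on `N` qubits: complex `2^N × 2^N` matrices, with the
`N`-fold tensor-product structure made explicit by indexing rows and columns by
functions `Fin N → Fin 2`. -/
abbrev QM (N : ℕ) := Matrix (Fin N → Fin 2) (Fin N → Fin 2) ℂ

/-- The Pauli matrix σ_x. -/
def sigx : Matrix (Fin 2) (Fin 2) ℂ := !![0, 1; 1, 0]

/-- The Pauli matrix σ_z. -/
def sigz : Matrix (Fin 2) (Fin 2) ℂ := !![1, 0; 0, -1]

/-- The tensor (Kronecker) product `f 0 ⊗ f 1 ⊗ ⋯ ⊗ f (N-1)` of single-qubit operators. -/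
def tensorAll (N : ℕ) (f : Fin N → Matrix (Fin 2) (Fin 2) ℂ) : QM N :=
  Matrix.of fun v w => ∏ i, f i (v i) (w i)

/-- The single-qubit operator `M` acting on qubit `m`, tensored with the identity
on all other qubits. -/
def site (N : ℕ) (m : Fin N) (M : Matrix (Fin 2) (Fin 2) ℂ) : QM N :=
  tensorAll N (fun i => if i = m then M else 1)

/-- Cluster-state stabilizer generator (0-based index `m : Fin N`): σ_x on qubit `m`
and σ_z on its nearest neighbour(s); it represents the 1-based generator `S_{m+1}`. -/
def clS (N : ℕ) (m : Fin N) : QM N :=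
  tensorAll N (fun i =>
    if i = m then sigx
    else if i.val + 1 = m.val ∨ m.val + 1 = i.val then sigz else 1)

/-- Factor `(I + S_{m+1})/2` of the cluster witness. -/
def clFactor (N : ℕ) (m : Fin N) : QM N := (1/2 : ℂ) • ((1 : QM N) + clS N m)

/-- Factor of the modified cluster witness: `(I + λ S_N)/2` for the last generator and
`(I + S_{m+1})/2` otherwise. -/
def clFactorMod (N : ℕ) (lam : ℝ) (m : Fin N) : QM N :=
  if m.val = N - 1 then (1/2 : ℂ) • ((1 : QM N) + (lam : ℂ) • clS N m)
  else (1/2 : ℂ) • ((1 : QM N) + clS N m)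

/-- Product of the cluster-witness factors over the 1-based indices `m+1` of parity
`r` (`r = 1` gives the even 1-based indices, `r = 0` the odd ones); the factors
pairwise commute, so the list ordering is immaterial. -/
def clProd (N : ℕ) (r : ℕ) : QM N :=
  (((List.finRange N).filter (fun m => m.val % 2 = r)).map (clFactor N)).prod

/-- The analogous parity product for the modified cluster witness; the factor carrying
`λ` (the one for `S_N`) lies in the even product when `N` is even and in the odd one
when `N` is odd. -/
def clProdMod (N : ℕ) (lam : ℝ) (r : ℕ) : QM N :=
  (((List.finRange N).filter (fun m => m.val % 2 = r)).map (clFactorMod N lam)).prod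

/-- The cluster-state genuine-multipartite-entanglement witness
`W_C = 3 I − 2 [∏_{even m}(I+S_m)/2 + ∏_{odd m}(I+S_m)/2]`. -/
def clWitness (N : ℕ) : QM N :=
  (3 : ℂ) • (1 : QM N) - (2 : ℂ) • (clProd N 1 + clProd N 0)

/-- The modified (unsharp) cluster witness `W_C^λ`, obtained from `W_C` by replacing
the factor `(I+S_N)/2` by `(I+λS_N)/2`. -/
def clWitnessMod (N : ℕ) (lam : ℝ) : QM N :=
  (3 : ℂ) • (1 : QM N) - (2 : ℂ) • (clProdMod N lam 1 + clProdMod N lam 0)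

/-- The controlled-Z gate acting on qubits `a` and `b` of an `N`-qubit system:
the diagonal unitary acting as `−1` on `|1⟩_a|1⟩_b` and `+1` on the other
computational basis states, tensored with the identity elsewhere. -/
def czGate (N : ℕ) (a b : Fin N) : QM N :=
  Matrix.of fun v w =>
    if v = w then (if v a = 1 ∧ v b = 1 then (-1 : ℂ) else 1) else 0

/-- The state `|+⟩^{⊗N}`. -/
def plusAll (N : ℕ) : (Fin N → Fin 2) → ℂ := fun _ => ((1 / Real.sqrt 2 : ℝ) : ℂ) ^ N

/-- The `N`-qubit linear cluster state `|C_N⟩ = (∏_{m=1}^{N-1} CZ_{m,m+1}) |+⟩^{⊗N}`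
(the CZ gates pairwise commute, so the ordering is immaterial). -/
def clusterVec (N : ℕ) : (Fin N → Fin 2) → ℂ :=
  (((List.finRange (N - 1)).map (fun i =>
      czGate N ⟨i.val, by have := i.isLt; omega⟩ ⟨i.val + 1, by have := i.isLt; omega⟩)).prod)
    *ᵥ plusAll N

/-- The rank-one projector `|ψ⟩⟨ψ|` onto a vector `ψ`. -/
def outer (N : ℕ) (ψ : (Fin N → Fin 2) → ℂ) : QM N :=
  Matrix.vecMulVec ψ (star ψ)

/-- The single-qubit unsharp-measurement channel
`Φ_λ(ρ) = ((2+√(1−λ²))/4)ρ + (1/4)σ_z ρ σ_z + ((1−√(1−λ²))/4)σ_x ρ σ_x`, applied to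
qubit `m` of an `N`-qubit operator (and acting as the identity on the other qubits). -/
def phiMap (N : ℕ) (m : Fin N) (lam : ℝ) (ρ : QM N) : QM N :=
  (((2 + Real.sqrt (1 - lam ^ 2)) / 4 : ℝ) : ℂ) • ρ
    + (1/4 : ℂ) • (site N m sigz * ρ * site N m sigz)
    + (((1 - Real.sqrt (1 - lam ^ 2)) / 4 : ℝ) : ℂ) • (site N m sigx * ρ * site N m sigx)

/-- The CZ phase. -/
def ee (a b : Fin 2) : ℂ := if a = 1 ∧ b = 1 then -1 else 1

/-- The total CZ phase. -/
def dd (n : ℕ) (v : Fin (n + 1) → Fin 2) : ℂ := ∏ i : Fin n, ee (v i.castSucc) (v i.succ)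

/-- Generalized factor. -/
def gF (N : ℕ) (α : Fin N → ℂ) (m : Fin N) : QM N := (1/2 : ℂ) • ((1 : QM N) + α m • clS N m)

/-- Generalized product. -/
def gP (N : ℕ) (α : Fin N → ℂ) (r : ℕ) : QM N :=
  (((List.finRange N).filter (fun m => m.val % 2 = r)).map (gF N α)).prod

lemma czList (n : ℕ) (l : List (Fin n)) (p : (Fin (n + 1) → Fin 2) → ℂ) :
    ((l.map (fun i => czGate (n + 1) i.castSucc i.succ)).prod) *ᵥ p
      = fun v => (l.map (fun i => ee (v i.castSucc) (v i.succ))).prod * p v := by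
  induction l with
  | nil => simp
  | cons a l ih =>
    rw [List.map_cons, List.prod_cons, ← Matrix.mulVec_mulVec, ih]
    funext v
    simp [Matrix.mulVec, dotProduct, czGate, ee, mul_assoc]

lemma clusterVec_eq (n : ℕ) (v : Fin (n + 1) → Fin 2) :
    clusterVec (n + 1) v = dd n v * ((1 / Real.sqrt 2 : ℝ) : ℂ) ^ (n + 1) := by
  have h := congrFun (czList n (List.finRange n) (plusAll (n + 1))) v
  rw [dd, Fin.prod_univ_def]
  exact h

lemma ee_sq (a b : Fin 2) : ee a b * star (ee a b) = 1 := by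
  unfold ee; split_ifs <;> simp

lemma dd_sq (n : ℕ) (v : Fin (n + 1) → Fin 2) : dd n v * star (dd n v) = 1 := by
  unfold dd
  rw [star_prod, ← Finset.prod_mul_distrib]
  exact Finset.prod_eq_one fun i _ => ee_sq _ _

lemma cluster_norm (n : ℕ) : clusterVec (n + 1) ⬝ᵥ star (clusterVec (n + 1)) = 1 := by
  have hc : ((1 / Real.sqrt 2 : ℝ) : ℂ) * ((1 / Real.sqrt 2 : ℝ) : ℂ) = 1 / 2 := by
    rw [← Complex.ofReal_mul, div_mul_div_comm, Real.mul_self_sqrt (by norm_num)]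
    norm_num
  have h : ∀ v, clusterVec (n + 1) v * star (clusterVec (n + 1)) v = (1 / 2 : ℂ) ^ (n + 1) := by
    intro v
    rw [Pi.star_apply, clusterVec_eq, star_mul', star_pow]
    have : star ((1 / Real.sqrt 2 : ℝ) : ℂ) = ((1 / Real.sqrt 2 : ℝ) : ℂ) := Complex.conj_ofReal _
    rw [this, mul_mul_mul_comm, dd_sq, ← mul_pow, hc, one_mul]
  rw [dotProduct, Finset.sum_congr rfl fun v _ => h v]
  simp [← mul_pow]

lemma flip_key (n : ℕ) (m : Fin (n + 1)) (v : Fin (n + 1) → Fin 2) :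
    (∏ i : Fin (n + 1), (if i = m then sigx
      else if i.val + 1 = m.val ∨ m.val + 1 = i.val then sigz else 1) (v i)
        (Function.update v m (1 - v m) i)) * dd n (Function.update v m (1 - v m)) = dd n v := by
  have h1 : (∏ i : Fin (n + 1), (if i = m then sigx
      else if i.val + 1 = m.val ∨ m.val + 1 = i.val then sigz else 1) (v i)
        (Function.update v m (1 - v m) i))
      = (∏ i : Fin (n + 1), if i.val + 1 = m.val then sigz (v i) (v i) else 1)
        * ∏ i : Fin (n + 1), if m.val + 1 = i.val then sigz (v i) (v i) else 1 := by
    rw [← Finset.prod_mul_distrib]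
    refine Finset.prod_congr rfl fun i _ => ?_
    by_cases hi : i = m
    · subst hi
      simp
      generalize v i = a
      fin_cases a <;> simp [sigx]
    · rw [if_neg hi, Function.update_of_ne hi]
      by_cases h1 : i.val + 1 = m.val
      · have h2 : ¬ (m.val + 1 = i.val) := by omega
        simp [h1, h2]
      · by_cases h2 : m.val + 1 = i.val
        · simp [h1, h2]
        · simp [h1, h2]
  rw [h1, Fin.prod_univ_castSucc, Fin.prod_univ_succ (fun i : Fin (n + 1) =>
    if m.val + 1 = i.val then sigz (v i) (v i) else 1)]
  have hl : ¬ ((Fin.last n).val + 1 = m.val) := by have := m.isLt; simp; omega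
  have h0 : ¬ (m.val + 1 = (0 : Fin (n + 1)).val) := by simp
  rw [if_neg hl, if_neg h0, mul_one, one_mul, dd, dd, ← Finset.prod_mul_distrib,
    ← Finset.prod_mul_distrib]
  refine Finset.prod_congr rfl fun i _ => ?_
  by_cases ha : i.castSucc = m
  · subst ha
    have hs : i.succ ≠ i.castSucc := by simp [Fin.ext_iff]
    rw [Function.update_self, Function.update_of_ne hs]
    simp
    generalize v i.castSucc = a
    generalize v i.succ = b
    fin_cases a <;> fin_cases b <;> simp [sigz, ee]
  · have ha' : ¬ (m.val + 1 = i.succ.val) := by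
      intro h; apply ha; ext; simp at h ⊢; omega
    rw [if_neg ha', Function.update_of_ne ha]
    by_cases hb : i.succ = m
    · subst hb
      rw [Function.update_self]
      simp
      generalize v i.castSucc = a
      generalize v i.succ = b
      fin_cases a <;> fin_cases b <;> simp [sigz, ee]
    · have hb' : ¬ (i.castSucc.val + 1 = m.val) := by
        intro h; apply hb; ext; simpa using h
      rw [if_neg hb', Function.update_of_ne hb]; simp

lemma clS_cluster (n : ℕ) (m : Fin (n + 1)) :
    clS (n + 1) m *ᵥ clusterVec (n + 1) = clusterVec (n + 1) := by
  funext v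
  rw [Matrix.mulVec, dotProduct, Finset.sum_eq_single (Function.update v m (1 - v m))]
  · rw [clusterVec_eq, clusterVec_eq, ← mul_assoc]
    congr 1
    exact flip_key n m v
  · intro w _ hw
    apply mul_eq_zero_of_left
    simp only [clS, tensorAll, Matrix.of_apply]
    obtain ⟨i, hi⟩ := Function.ne_iff.mp hw
    refine Finset.prod_eq_zero (Finset.mem_univ i) ?_
    by_cases h : i = m
    · subst h
      rw [if_pos rfl]
      rw [Function.update_self] at hi
      revert hi
      generalize v i = a
      generalize w i = b
      fin_cases a <;> fin_cases b <;> simp [sigx]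
    · rw [if_neg h]
      rw [Function.update_of_ne h] at hi
      split_ifs
      · revert hi
        generalize v i = a
        generalize w i = b
        fin_cases a <;> fin_cases b <;> simp [sigz]
      · exact Matrix.one_apply_ne (Ne.symm hi)
  · simp

lemma gF_cluster (n : ℕ) (α : Fin (n + 1) → ℂ) (m : Fin (n + 1)) :
    gF (n + 1) α m *ᵥ clusterVec (n + 1) = ((1 + α m) / 2) • clusterVec (n + 1) := by
  rw [gF, Matrix.smul_mulVec, Matrix.add_mulVec, Matrix.one_mulVec, Matrix.smul_mulVec,
    clS_cluster]
  module

lemma gP_cluster (n : ℕ) (α : Fin (n + 1) → ℂ) (r : ℕ) :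
    gP (n + 1) α r *ᵥ clusterVec (n + 1)
      = (∏ m : Fin (n + 1), if m.val % 2 = r then (1 + α m) / 2 else 1) •
        clusterVec (n + 1) := by
  rw [Fin.prod_univ_def, gP]
  induction List.finRange (n + 1) with
  | nil => simp
  | cons a l ih =>
    by_cases h : a.val % 2 = r
    · rw [List.filter_cons_of_pos (by simpa using h), List.map_cons, List.prod_cons,
        ← Matrix.mulVec_mulVec, ih, Matrix.mulVec_smul, gF_cluster, List.map_cons, List.prod_cons,
        if_pos h, smul_smul, mul_comm]
    · rw [List.filter_cons_of_neg (by simpa using h), ih, List.map_cons, List.prod_cons,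
        if_neg h, one_mul]

lemma gP_trace (n : ℕ) (α : Fin (n + 1) → ℂ) (r : ℕ) :
    (gP (n + 1) α r * outer (n + 1) (clusterVec (n + 1))).trace
      = ∏ m : Fin (n + 1), if m.val % 2 = r then (1 + α m) / 2 else 1 := by
  rw [outer, Matrix.mul_vecMulVec, gP_cluster, Matrix.trace_vecMulVec, smul_dotProduct,
    cluster_norm]
  simp

lemma tensorAll_mul (N : ℕ) (f g : Fin N → Matrix (Fin 2) (Fin 2) ℂ) :
    tensorAll N f * tensorAll N g = tensorAll N (fun i => f i * g i) := by
  ext v w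
  simp only [tensorAll, Matrix.mul_apply, Matrix.of_apply]
  rw [Finset.prod_univ_sum, Fintype.piFinset_univ]
  exact Finset.sum_congr rfl fun x _ => Finset.prod_mul_distrib.symm

lemma tensorAll_one (N : ℕ) : tensorAll N (fun _ => 1) = 1 := by
  ext v w
  simp only [tensorAll, Matrix.of_apply]
  by_cases h : v = w
  · subst h; simp
  · rw [Matrix.one_apply_ne h]
    obtain ⟨i, hi⟩ := Function.ne_iff.mp h
    exact Finset.prod_eq_zero (Finset.mem_univ i) (Matrix.one_apply_ne hi)

lemma tensorAll_smul (N : ℕ) (c : Fin N → ℂ) (f : Fin N → Matrix (Fin 2) (Fin 2) ℂ) :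
    tensorAll N (fun i => c i • f i) = (∏ i, c i) • tensorAll N f := by
  ext v w
  simp [tensorAll, Finset.prod_mul_distrib]

lemma sigx_sq : sigx * sigx = 1 := by
  ext i j; fin_cases i <;> fin_cases j <;> simp [sigx]
lemma sigz_sq : sigz * sigz = 1 := by
  ext i j; fin_cases i <;> fin_cases j <;> simp [sigz]
lemma zxz : sigz * sigx * sigz = (-1 : ℂ) • sigx := by
  ext i j; fin_cases i <;> fin_cases j <;> simp [sigx, sigz]
lemma xzx : sigx * sigz * sigx = (-1 : ℂ) • sigz := by
  ext i j; fin_cases i <;> fin_cases j <;> simp [sigx, sigz]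

lemma site_sq (N : ℕ) (m : Fin N) (M : Matrix (Fin 2) (Fin 2) ℂ) (h : M * M = 1) :
    site N m M * site N m M = 1 := by
  rw [site, tensorAll_mul, ← tensorAll_one]
  congr 1; funext i; split_ifs <;> simp [h]

lemma site_conj (N : ℕ) (p : Fin N) (M : Matrix (Fin 2) (Fin 2) ℂ)
    (f : Fin N → Matrix (Fin 2) (Fin 2) ℂ) (c : ℂ) (h : M * f p * M = c • f p) :
    site N p M * tensorAll N f * site N p M = c • tensorAll N f := by
  have : c = ∏ i, (if i = p then c else 1) := by simp
  rw [site, tensorAll_mul, tensorAll_mul]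
  conv_rhs => rw [this, ← tensorAll_smul]
  congr 1; funext i
  by_cases hi : i = p
  · subst hi; simp [h]
  · simp [hi]

lemma conjZ (N : ℕ) (p m : Fin N) :
    site N p sigz * clS N m * site N p sigz = (if m = p then (-1 : ℂ) else 1) • clS N m := by
  apply site_conj
  by_cases h : p = m
  · subst h; simp only [if_true]; exact zxz
  · rw [if_neg h, if_neg (Ne.symm h)]
    split_ifs <;> simp [sigz_sq]

lemma conjX (N : ℕ) (p m : Fin N) :
    site N p sigx * clS N m * site N p sigx
      = (if p.val + 1 = m.val ∨ m.val + 1 = p.val then (-1 : ℂ) else 1) • clS N m := by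
  apply site_conj
  by_cases h : p = m
  · subst h; simp [sigx_sq]
  · rw [if_neg h]
    split_ifs
    · exact xzx
    · simp [sigx_sq]

lemma gP_conj (N : ℕ) (U : QM N) (hU : U * U = 1) (σ α : Fin N → ℂ)
    (h : ∀ m, U * clS N m * U = σ m • clS N m) (r : ℕ) :
    U * gP N α r * U = gP N (fun m => σ m * α m) r := by
  unfold gP
  induction (List.finRange N).filter (fun m => m.val % 2 = r) with
  | nil => simp [hU]
  | cons a l ih =>
    rw [List.map_cons, List.prod_cons, List.map_cons, List.prod_cons, ← ih]
    have hF : U * gF N α a * U = gF N (fun m => σ m * α m) a := by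
      simp only [gF, mul_smul_comm, smul_mul_assoc, mul_add, add_mul, mul_one, hU, h, smul_smul]
      rw [mul_comm (α a)]
    rw [← hF]
    calc U * (gF N α a * (List.map (gF N α) l).prod) * U
        = U * gF N α a * 1 * (List.map (gF N α) l).prod * U := by simp only [mul_assoc, one_mul]
      _ = _ := by rw [← hU]; simp only [mul_assoc]

lemma trace_conj (N : ℕ) (U P R : QM N) :
    (P * (U * R * U)).trace = (U * P * U * R).trace := by
  rw [← mul_assoc, Matrix.trace_mul_comm]
  simp only [mul_assoc]

lemma gP_phi (N : ℕ) (p : Fin N) (l : ℝ) (R : QM N) (α : Fin N → ℂ) (r : ℕ) :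
    (gP N α r * phiMap N p l R).trace
      = (((2 + Real.sqrt (1 - l ^ 2)) / 4 : ℝ) : ℂ) * (gP N α r * R).trace
        + (1/4 : ℂ) * (gP N (fun m => (if m = p then (-1 : ℂ) else 1) * α m) r * R).trace
        + (((1 - Real.sqrt (1 - l ^ 2)) / 4 : ℝ) : ℂ) *
          (gP N (fun m => (if p.val + 1 = m.val ∨ m.val + 1 = p.val then (-1 : ℂ) else 1) * α m) r
            * R).trace := by
  rw [phiMap, mul_add, mul_add, Matrix.trace_add, Matrix.trace_add, mul_smul_comm, mul_smul_comm,
    mul_smul_comm, Matrix.trace_smul, Matrix.trace_smul, Matrix.trace_smul, trace_conj, trace_conj,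
    gP_conj N _ (site_sq N p _ sigz_sq) _ α (conjZ N p),
    gP_conj N _ (site_sq N p _ sigx_sq) _ α (conjX N p)]
  simp only [smul_eq_mul]

lemma phi_trace (N : ℕ) (p : Fin N) (l : ℝ) (R : QM N) :
    (phiMap N p l R).trace = R.trace := by
  have hz := trace_conj N (site N p sigz) 1 R
  have hx := trace_conj N (site N p sigx) 1 R
  rw [mul_one, site_sq N p _ sigz_sq, one_mul, one_mul] at hz
  rw [mul_one, site_sq N p _ sigx_sq, one_mul, one_mul] at hx
  rw [phiMap, Matrix.trace_add, Matrix.trace_add, Matrix.trace_smul, Matrix.trace_smul,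
    Matrix.trace_smul, hz, hx]
  simp only [smul_eq_mul]
  push_cast
  ring

lemma main_ind (n : ℕ) (lam : ℕ → ℝ) (ρ : ℕ → QM (n + 3))
    (hinit : ρ 1 = outer (n + 3) (clusterVec (n + 3)))
    (hrec : ∀ k, 1 ≤ k → ρ (k + 1) = phiMap (n + 3) ⟨n + 2, by omega⟩ (lam k) (ρ k)) (k : ℕ) :
    (ρ (k + 1)).trace = 1 ∧
    ∀ α : Fin (n + 3) → ℂ, (∀ m, m.val < n + 1 → α m = 1) →
      (gP (n + 3) α ((n + 2) % 2) * ρ (k + 1)).trace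
        = (1 + α ⟨n + 2, by omega⟩ * (1 / 2 ^ k)) / 2 ∧
      (gP (n + 3) α ((n + 1) % 2) * ρ (k + 1)).trace
        = (1 + α ⟨n + 1, by omega⟩ *
          ((∏ j ∈ Finset.Icc 1 k, (1 + Real.sqrt (1 - lam j ^ 2)) / 2 : ℝ) : ℂ)) / 2 := by
  induction k with
  | zero =>
    rw [zero_add, hinit]
    refine ⟨?_, fun α hα => ⟨?_, ?_⟩⟩
    · rw [outer, Matrix.trace_vecMulVec, cluster_norm]
    · rw [gP_trace, Finset.prod_eq_single (⟨n + 2, by omega⟩ : Fin (n + 3))]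
      · simp
      · intro m _ hm
        split_ifs with h
        · have : m.val ≠ n + 2 := fun h => hm (Fin.ext h)
          rw [hα m (by have := m.isLt; omega)]; norm_num
        · rfl
      · simp
    · rw [gP_trace, Finset.prod_eq_single (⟨n + 1, by omega⟩ : Fin (n + 3))]
      · simp
      · intro m _ hm
        split_ifs with h
        · have : m.val ≠ n + 1 := fun h => hm (Fin.ext h)
          rw [hα m (by have := m.isLt; omega)]; norm_num
        · rfl
      · simp
  | succ k ih =>
    obtain ⟨ih0, ih1⟩ := ih
    rw [hrec (k + 1) (by omega)]
    refine ⟨by rw [phi_trace, ih0], fun α hα => ?_⟩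
    have hZ := ih1 (fun m => (if m = (⟨n + 2, by omega⟩ : Fin (n + 3)) then (-1 : ℂ) else 1) * α m)
      (by
        intro m hm
        have : m ≠ (⟨n + 2, by omega⟩ : Fin (n + 3)) := by
          intro h; rw [h] at hm; simp at hm
        simp only [if_neg this, hα m hm, mul_one])
    have hX := ih1 (fun m => (if (⟨n + 2, by omega⟩ : Fin (n + 3)).val + 1 = m.val ∨
        m.val + 1 = (⟨n + 2, by omega⟩ : Fin (n + 3)).val then (-1 : ℂ) else 1) * α m)
      (by
        intro m hm
        rw [if_neg (by simp only; omega), hα m hm, mul_one])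
    have h1 := ih1 α hα
    rw [gP_phi, gP_phi, h1.1, h1.2, hZ.1, hZ.2, hX.1, hX.2,
      Finset.prod_Icc_succ_top (by omega : 1 ≤ k + 1)]
    simp only [Fin.ext_iff]
    norm_num
    constructor
    · rw [pow_succ]; field_simp; ring
    · ring

/-- Fix an integer `N ≥ 3` and parameters `λ_1, λ_2, …` in `[0,1]`.
Let `ρ_1 = |C_N⟩⟨C_N|` be the `N`-qubit linear cluster state and
`ρ_k = (id ⊗ Φ_{λ_{k−1}})(ρ_{k−1})` for `k ≥ 2` (the map acting on the `N`-th qubit).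
Then for every `k ≥ 1`,
`Tr(W_C^{λ_k} ρ_k) = 1 − ∏_{j=1}^{k−1} (1+√(1−λ_j²))/2 − λ_k/2^{k−1}`.
Consequently the `k`-th sequential observer detects genuine multipartite entanglement,
i.e. `Tr(W_C^{λ_k} ρ_k) < 0`, if and only if
`λ_k > 2^{k−1}·[1 − ∏_{j=1}^{k−1} (1+√(1−λ_j²))/2]` — the same `N`-independent
condition as for the GHZ state. -/
theorem cluster_sequential_witness_trace
    (N : ℕ) (hN : 3 ≤ N)
    (lam : ℕ → ℝ) (hlam : ∀ j, lam j ∈ Set.Icc (0 : ℝ) 1)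
    (ρ : ℕ → QM N)
    (hinit : ρ 1 = outer N (clusterVec N))
    (hrec : ∀ k, 1 ≤ k → ρ (k + 1) = phiMap N ⟨N - 1, by omega⟩ (lam k) (ρ k)) :
    ∀ k, 1 ≤ k →
      (clWitnessMod N (lam k) * ρ k).trace
        = ((1 - ∏ j ∈ Finset.Icc 1 (k - 1), (1 + Real.sqrt (1 - lam j ^ 2)) / 2
            - lam k / 2 ^ (k - 1) : ℝ) : ℂ) ∧
      (((clWitnessMod N (lam k) * ρ k).trace).re < 0 ↔
        lam k > (2 : ℝ) ^ (k - 1)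
          * (1 - ∏ j ∈ Finset.Icc 1 (k - 1), (1 + Real.sqrt (1 - lam j ^ 2)) / 2)) := by
  obtain ⟨n, rfl⟩ : ∃ n, N = n + 3 := ⟨N - 3, by omega⟩
  intro k hk
  obtain ⟨k, rfl⟩ : ∃ j, k = j + 1 := ⟨k - 1, by omega⟩
  have key : (clWitnessMod (n + 3) (lam (k + 1)) * ρ (k + 1)).trace
        = ((1 - ∏ j ∈ Finset.Icc 1 (k + 1 - 1), (1 + Real.sqrt (1 - lam j ^ 2)) / 2
            - lam (k + 1) / 2 ^ (k + 1 - 1) : ℝ) : ℂ) := by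
    obtain ⟨h0, h1⟩ := main_ind n lam ρ hinit hrec k
    obtain ⟨ha, hb⟩ := h1 (fun m => if m.val = n + 2 then (lam (k + 1) : ℂ) else 1)
      (by intro m hm; rw [if_neg (by omega)])
    have hF : clFactorMod (n + 3) (lam (k + 1))
        = gF (n + 3) (fun m => if m.val = n + 2 then (lam (k + 1) : ℂ) else 1) := by
      funext m
      by_cases h : m.val = n + 2
      · simp [clFactorMod, gF, h]
      · simp [clFactorMod, gF, h]
    have hP : ∀ r, clProdMod (n + 3) (lam (k + 1)) r
        = gP (n + 3) (fun m => if m.val = n + 2 then (lam (k + 1) : ℂ) else 1) r := by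
      intro r; rw [clProdMod, hF, gP]
    have hW : clProdMod (n + 3) (lam (k + 1)) 1 + clProdMod (n + 3) (lam (k + 1)) 0
        = clProdMod (n + 3) (lam (k + 1)) ((n + 2) % 2)
          + clProdMod (n + 3) (lam (k + 1)) ((n + 1) % 2) := by
      rcases Nat.mod_two_eq_zero_or_one n with h | h
      · rw [show (n + 2) % 2 = 0 by omega, show (n + 1) % 2 = 1 by omega]; exact add_comm _ _
      · rw [show (n + 2) % 2 = 1 by omega, show (n + 1) % 2 = 0 by omega]
    rw [clWitnessMod, hW, hP, hP, sub_mul, smul_mul_assoc, smul_mul_assoc, one_mul, add_mul,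
      Matrix.trace_sub, Matrix.trace_smul, Matrix.trace_smul, Matrix.trace_add, h0, ha, hb]
    simp
    ring
  refine ⟨key, ?_⟩
  rw [key, Complex.ofReal_re]
  have h2 : (0 : ℝ) < 2 ^ (k + 1 - 1) := by positivity
  rw [gt_iff_lt, sub_neg, lt_div_iff₀ h2, mul_comm]

end
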